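/- Let p > 1 and a, b > 0, let w = (b/a) · Z(p−2,a,b)/Z(p,a,b), and for q ∈ ℝ define the GIG(q,a,b) CDF G_q(x) = (1/Z(q,a,b)) ∫₀^x t^{q−1} exp(−(a t + b/t)/2) dt, and let Γ(s,z) = ∫_z^∞ t^{s−1} e^{−t} dt denote the upper incomplete gamma function. Then for every x > 0: G_p(x) = w · G_{p−2}(x) + (1−w) · G_{p−1}(x) − exp(−a x/2) · [ w · (b/2)^{p−2} · Γ(2−p, b/(2x)) / Z(p−2,a,b) + (1−w) · (b/2)^{p−1} · Γ(1−p, b/(2x)) / Z(p−1,a,b) ]. (This is the CDF recurrence of Proposition 5; in Bessel-function form the bracketed term equals I_p(x) = w (ab)^{(p−2)/2} Γ(2−p, b/(2x)) / (2^{p−1} K_{p−2}(√(ab))) + (1−w) (ab)^{(p−1)/2} Γ(1−p, b/(2x)) / (2^{p} K_{p−1}(√(ab))).) -/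

import Mathlib

open Real MeasureTheory Set

/-- The (unnormalized) kernel of the GIG(p,a,b) distribution. -/
noncomputable def gigKernel (p a b x : ℝ) : ℝ :=
  x ^ (p - 1) * Real.exp (-((a * x + b / x) / 2))

/-- The normalizing constant Z(p,a,b) of the GIG(p,a,b) distribution. -/
noncomputable def gigZ (p a b : ℝ) : ℝ :=
  ∫ x in Ioi (0 : ℝ), gigKernel p a b x

/-- The probability density function of the GIG(p,a,b) distribution. -/
noncomputable def gigPdf (p a b x : ℝ) : ℝ :=
  gigKernel p a b x / gigZ p a b

/-- The inverse Gaussian InvGauss(μ,λ) density. -/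
noncomputable def invGaussPdf (μ lam x : ℝ) : ℝ :=
  Real.sqrt (lam / (2 * Real.pi * x ^ 3)) *
    Real.exp (-(lam * (x - μ) ^ 2) / (2 * μ ^ 2 * x))

/-- The Gamma(α,β) density (shape α, rate β). -/
noncomputable def gammaPdf (α β y : ℝ) : ℝ :=
  β ^ α * y ^ (α - 1) * Real.exp (-(β * y)) / Real.Gamma α

/-- The upper incomplete gamma function Γ(s,z) = ∫_z^∞ t^{s-1} e^{-t} dt. -/
noncomputable def upperGamma (s z : ℝ) : ℝ :=
  ∫ t in Ioi z, t ^ (s - 1) * Real.exp (-t)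

/-- The CDF of the GIG(q,a,b) distribution. -/
noncomputable def gigCDF (q a b x : ℝ) : ℝ :=
  (1 / gigZ q a b) * ∫ t in Ioo (0 : ℝ) x, gigKernel q a b t

lemma gigKernel_pos (q a b : ℝ) {x : ℝ} (hx : 0 < x) : 0 < gigKernel q a b x :=
  mul_pos (rpow_pos_of_pos hx _) (Real.exp_pos _)

lemma continuousOn_gigKernel (q a b : ℝ) : ContinuousOn (gigKernel q a b) (Ioi 0) := by
  intro x hx
  have hx0 : x ≠ 0 := ne_of_gt hx
  unfold gigKernel
  apply ContinuousAt.continuousWithinAt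
  fun_prop (disch := simp [hx0])

/-- The essential singularity of `exp (-b / (2 * x))` at `0` makes every GIG kernel integrable. -/
lemma integrableOn_gigKernel (q : ℝ) {a b : ℝ} (ha : 0 < a) (hb : 0 < b) :
    IntegrableOn (gigKernel q a b) (Ioi 0) := by
  obtain ⟨n, hn⟩ := exists_nat_gt (-q)
  have hint := (integrableOn_rpow_mul_exp_neg_mul_rpow (p := 1) (s := q - 1 + n) (b := a / 2)
    (by linarith) one_pos (by positivity)).const_mul ((n.factorial : ℝ) * (2 / b) ^ n)
  refine Integrable.mono' hint
    ((continuousOn_gigKernel q a b).aestronglyMeasurable measurableSet_Ioi) ?_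
  filter_upwards [ae_restrict_mem measurableSet_Ioi] with x (hx : 0 < x)
  rw [Real.norm_of_nonneg (gigKernel_pos q a b hx).le]
  have hy : 0 < b / (2 * x) := by positivity
  have hexp : Real.exp (-(b / (2 * x))) ≤ n.factorial * (2 / b) ^ n * x ^ n := by
    have h := Real.pow_div_factorial_le_exp _ hy.le n
    rw [Real.exp_neg]
    calc (Real.exp (b / (2 * x)))⁻¹ ≤ ((b / (2 * x)) ^ n / n.factorial)⁻¹ :=
          inv_anti₀ (by positivity) h
      _ = n.factorial * (2 / b) ^ n * x ^ n := by
          rw [inv_div, div_eq_mul_inv, ← inv_pow, inv_div, mul_assoc, ← mul_pow, div_mul_eq_mul_div]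
  calc gigKernel q a b x
      = x ^ (q - 1) * Real.exp (-(a / 2) * x) * Real.exp (-(b / (2 * x))) := by
        rw [gigKernel, mul_assoc, ← Real.exp_add]
        congr 2
        field_simp
        ring
    _ ≤ x ^ (q - 1) * Real.exp (-(a / 2) * x) * (n.factorial * (2 / b) ^ n * x ^ n) := by
        gcongr
    _ = _ := by
        rw [rpow_add hx, rpow_natCast, rpow_one]
        ring

lemma gigZ_pos (q : ℝ) {a b : ℝ} (ha : 0 < a) (hb : 0 < b) : 0 < gigZ q a b := by
  refine (setIntegral_pos_iff_support_of_nonneg_ae ?_ (integrableOn_gigKernel q ha hb)).2 ?_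
  · filter_upwards [ae_restrict_mem measurableSet_Ioi] with x hx using (gigKernel_pos q a b hx).le
  · have hsub : Ioi (0 : ℝ) ⊆ Function.support (gigKernel q a b) :=
      fun x hx => (gigKernel_pos q a b hx).ne'
    rw [inter_eq_right.2 hsub]
    simp

lemma hasDerivAt_gigKernel (q a b : ℝ) {x : ℝ} (hx : 0 < x) :
    HasDerivAt (gigKernel q a b)
      (b / 2 * gigKernel (q - 2) a b x + (q - 1) * gigKernel (q - 1) a b x
        - a / 2 * gigKernel q a b x) x := by
  have hx0 := hx.ne'
  have h := (Real.hasDerivAt_rpow_const (x := x) (p := q - 1) (Or.inl hx0)).mul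
    ((((hasDerivAt_id x).const_mul a).add ((hasDerivAt_inv hx0).const_mul b)).div_const 2).neg.exp
  have e1 : x ^ (q - 2 - 1) = x ^ (q - 1) / x ^ 2 := by
    rw [← rpow_natCast x 2, ← rpow_sub hx]
    congr 1
    push_cast
    ring
  have e2 : x ^ (q - 1 - 1) = x ^ (q - 1) / x := rpow_sub_one hx0 _
  refine (h.congr_deriv ?_).congr_of_eventuallyEq (.of_forall fun y => ?_)
  · simp only [gigKernel, e1, e2, Pi.add_apply, Pi.neg_apply, id, div_eq_mul_inv]
    ring
  · simp [gigKernel, div_eq_mul_inv]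

lemma gigKernel_le (q : ℝ) {a b x : ℝ} (hb : 0 < b) (hx : 0 < x) :
    gigKernel q a b x ≤ x ^ (q - 1) * Real.exp (-(a / 2) * x) := by
  unfold gigKernel
  gcongr
  have : 0 < b / x := by positivity
  linarith

lemma tendsto_gigKernel_zero {q a b : ℝ} (hq : 1 < q) (hb : 0 < b) :
    Filter.Tendsto (gigKernel q a b) (nhdsWithin 0 (Ioi 0)) (nhds 0) := by
  have hlim : Filter.Tendsto (fun x : ℝ => x ^ (q - 1) * Real.exp (-(a / 2) * x))
      (nhds 0) (nhds 0) := by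
    have hcont : ContinuousAt (fun x : ℝ => x ^ (q - 1) * Real.exp (-(a / 2) * x)) 0 :=
      (continuousAt_rpow_const _ _ (Or.inr (by linarith))).mul (by fun_prop)
    have h := hcont.tendsto
    rwa [zero_rpow (by linarith), zero_mul] at h
  refine squeeze_zero' ?_ ?_ (hlim.mono_left nhdsWithin_le_nhds)
  · filter_upwards [self_mem_nhdsWithin] with x hx using (gigKernel_pos q a b hx).le
  · filter_upwards [self_mem_nhdsWithin] with x hx using gigKernel_le q hb hx

lemma tendsto_gigKernel_atTop (q : ℝ) {a b : ℝ} (ha : 0 < a) (hb : 0 < b) :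
    Filter.Tendsto (gigKernel q a b) Filter.atTop (nhds 0) := by
  refine squeeze_zero' ?_ ?_
    (tendsto_rpow_mul_exp_neg_mul_atTop_nhds_zero (q - 1) (a / 2) (by positivity))
  · filter_upwards [Filter.eventually_gt_atTop 0] with x hx using (gigKernel_pos q a b hx).le
  · filter_upwards [Filter.eventually_gt_atTop 0] with x hx using gigKernel_le q hb hx

lemma setIntegral_deriv_gigKernel (q : ℝ) {a b : ℝ} (ha : 0 < a) (hb : 0 < b) {s : Set ℝ}
    (hs : s ⊆ Ioi 0) :
    ∫ t in s, (b / 2 * gigKernel (q - 2) a b t + (q - 1) * gigKernel (q - 1) a b t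
        - a / 2 * gigKernel q a b t) =
      b / 2 * (∫ t in s, gigKernel (q - 2) a b t) + (q - 1) * (∫ t in s, gigKernel (q - 1) a b t)
        - a / 2 * ∫ t in s, gigKernel q a b t := by
  have hi (r c : ℝ) : IntegrableOn (fun t => c * gigKernel r a b t) s :=
    ((integrableOn_gigKernel r ha hb).mono_set hs).const_mul c
  have h := integral_sub ((hi (q - 2) (b / 2)).add (hi (q - 1) (q - 1))) (hi q (a / 2))
  have h' := integral_add (hi (q - 2) (b / 2)) (hi (q - 1) (q - 1))
  simp only [Pi.add_apply] at h
  rw [h, h']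
  simp only [integral_const_mul]

lemma integrableOn_deriv_gigKernel (q : ℝ) {a b : ℝ} (ha : 0 < a) (hb : 0 < b) :
    IntegrableOn (fun t => b / 2 * gigKernel (q - 2) a b t + (q - 1) * gigKernel (q - 1) a b t
      - a / 2 * gigKernel q a b t) (Ioi 0) :=
  (((integrableOn_gigKernel _ ha hb).const_mul _).add
    ((integrableOn_gigKernel _ ha hb).const_mul _)).sub
    ((integrableOn_gigKernel _ ha hb).const_mul _)

lemma gigZ_recurrence {q a b : ℝ} (hq : 1 < q) (ha : 0 < a) (hb : 0 < b) :
    b / 2 * gigZ (q - 2) a b + (q - 1) * gigZ (q - 1) a b = a / 2 * gigZ q a b := by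
  have hzero : gigKernel q a b 0 = 0 := by
    rw [gigKernel, zero_rpow (by linarith), zero_mul]
  have hcont : ContinuousWithinAt (gigKernel q a b) (Ici 0) 0 := by
    rw [← continuousWithinAt_Ioi_iff_Ici, ContinuousWithinAt, hzero]
    exact tendsto_gigKernel_zero hq hb
  have h := integral_Ioi_of_hasDerivAt_of_tendsto hcont
    (fun x hx => hasDerivAt_gigKernel q a b hx) (integrableOn_deriv_gigKernel q ha hb)
    (tendsto_gigKernel_atTop q ha hb)
  rw [hzero, setIntegral_deriv_gigKernel q ha hb subset_rfl] at h
  unfold gigZ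
  linarith

lemma integral_gigKernel_recurrence {q a b : ℝ} (hq : 1 < q) (ha : 0 < a) (hb : 0 < b)
    {x : ℝ} (hx : 0 < x) :
    b / 2 * (∫ t in Ioo 0 x, gigKernel (q - 2) a b t)
        + (q - 1) * (∫ t in Ioo 0 x, gigKernel (q - 1) a b t)
        - a / 2 * (∫ t in Ioo 0 x, gigKernel q a b t) = gigKernel q a b x := by
  have hint : IntervalIntegrable (fun t => b / 2 * gigKernel (q - 2) a b t
      + (q - 1) * gigKernel (q - 1) a b t - a / 2 * gigKernel q a b t) volume 0 x :=
    (intervalIntegrable_iff_integrableOn_Ioc_of_le hx.le).2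
      ((integrableOn_deriv_gigKernel q ha hb).mono_set Ioc_subset_Ioi_self)
  have h := intervalIntegral.integral_eq_sub_of_hasDerivAt_of_tendsto hx
    (fun t ht => hasDerivAt_gigKernel q a b ht.1) hint (tendsto_gigKernel_zero hq hb)
    ((hasDerivAt_gigKernel q a b hx).continuousAt.tendsto.mono_left nhdsWithin_le_nhds)
  rwa [intervalIntegral.integral_of_le hx.le, integral_Ioc_eq_integral_Ioo,
    setIntegral_deriv_gigKernel q ha hb Ioo_subset_Ioi_self, sub_zero] at h

lemma integrableOn_rpow_mul_exp_neg_Ioi (s : ℝ) {z : ℝ} (hz : 0 < z) :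
    IntegrableOn (fun t : ℝ => t ^ s * Real.exp (-t)) (Ioi z) := by
  refine integrable_of_isBigO_exp_neg (b := 1 / 2) (by norm_num) ?_ ?_
  · intro t ht
    have ht0 : t ≠ 0 := (hz.trans_le ht).ne'
    apply ContinuousAt.continuousWithinAt
    fun_prop (disch := simp [ht0])
  · simpa only [mul_comm] using (Real.Gamma_integrand_isLittleO s).isBigO

lemma upperGamma_add_one (s : ℝ) {z : ℝ} (hz : 0 < z) :
    upperGamma (s + 1) z = s * upperGamma s z + z ^ s * Real.exp (-z) := by
  have hderiv : ∀ t ∈ Ici z, HasDerivAt (fun t : ℝ => t ^ s * Real.exp (-t))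
      (s * (t ^ (s - 1) * Real.exp (-t)) - t ^ (s + 1 - 1) * Real.exp (-t)) t := by
    intro t ht
    have ht0 : t ≠ 0 := (hz.trans_le ht).ne'
    refine ((Real.hasDerivAt_rpow_const (p := s) (Or.inl ht0)).mul
      (hasDerivAt_neg t).exp).congr_deriv ?_
    rw [add_sub_cancel_right]
    ring
  have h1 := (integrableOn_rpow_mul_exp_neg_Ioi (s - 1) hz).const_mul s
  have h2 := integrableOn_rpow_mul_exp_neg_Ioi (s + 1 - 1) hz
  have hlim : Filter.Tendsto (fun t : ℝ => t ^ s * Real.exp (-t)) Filter.atTop (nhds 0) := by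
    simpa using tendsto_rpow_mul_exp_neg_mul_atTop_nhds_zero s 1 one_pos
  have h := integral_Ioi_of_hasDerivAt_of_tendsto' hderiv (h1.sub h2) hlim
  rw [integral_sub h1 h2, integral_const_mul] at h
  unfold upperGamma
  linarith

lemma upperGamma_combination_eq_gigKernel (p a : ℝ) {b x : ℝ} (hb : 0 < b) (hx : 0 < x) :
    Real.exp (-a * x / 2) * ((b / 2) ^ (p - 1) *
      (upperGamma (2 - p) (b / (2 * x)) + (p - 1) * upperGamma (1 - p) (b / (2 * x)))) =
      gigKernel p a b x := by
  have hz : 0 < b / (2 * x) := by positivity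
  have h := upperGamma_add_one (1 - p) hz
  rw [show 1 - p + 1 = 2 - p by ring] at h
  have hpow : (b / 2) ^ (p - 1) * (b / (2 * x)) ^ (1 - p) = x ^ (p - 1) := by
    rw [show 1 - p = -(p - 1) by ring, rpow_neg hz.le, ← div_eq_mul_inv,
      ← div_rpow (by positivity) hz.le]
    congr 1
    field_simp
  have hexp : Real.exp (-a * x / 2) * Real.exp (-(b / (2 * x))) =
      Real.exp (-((a * x + b / x) / 2)) := by
    rw [← Real.exp_add]
    congr 1
    field_simp
    ring
  rw [h, gigKernel, ← hpow, ← hexp]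
  ring

/-- Proposition 5: the CDF recurrence for the GIG with p > 1. -/
theorem gigCDF_recurrence (p a b : ℝ) (hp : 1 < p) (ha : 0 < a) (hb : 0 < b)
    (w : ℝ) (hw : w = (b / a) * gigZ (p - 2) a b / gigZ p a b)
    (x : ℝ) (hx : 0 < x) :
    gigCDF p a b x =
      w * gigCDF (p - 2) a b x + (1 - w) * gigCDF (p - 1) a b x -
        Real.exp (-a * x / 2) *
          (w * (b / 2) ^ (p - 2) * upperGamma (2 - p) (b / (2 * x)) / gigZ (p - 2) a b +
            (1 - w) * (b / 2) ^ (p - 1) * upperGamma (1 - p) (b / (2 * x)) / gigZ (p - 1) a b) := by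
  have hZ := gigZ_pos p ha hb
  have hZ1 := gigZ_pos (p - 1) ha hb
  have hZ2 := gigZ_pos (p - 2) ha hb
  have hw' : 1 - w = 2 * (p - 1) / a * gigZ (p - 1) a b / gigZ p a b := by
    rw [hw]
    field_simp
    linarith [gigZ_recurrence hp ha hb]
  have hpow : (b / 2) ^ (p - 1) = (b / 2) ^ (p - 2) * (b / 2) := by
    rw [← rpow_add_one (by positivity)]
    congr 1
    ring
  have hF := integral_gigKernel_recurrence hp ha hb hx
  rw [← upperGamma_combination_eq_gigKernel p a hb hx] at hF
  rw [hw', hw, hpow]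
  rw [hpow] at hF
  unfold gigCDF
  field_simp
  field_simp at hF
  linarith
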